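/- For every t ≥ 2, the t-stage (ℓ_1, Plu)-rule (SNTV at every stage, where Plu^{m,k}(p) = 1 if p = 1 and 0 otherwise; in particular the STV procedure) does not satisfy Candidate Monotonicity. -/

import Mathlib

/-- Position (1-indexed) of candidate `c` in voter `v`'s induced ranking on the
pool `C` (voters are ranking functions, smaller value = more preferred). -/
def posIn {α : Type} (v : α → ℕ) (C : Finset α) (c : α) : ℕ :=
  (C.filter fun c' => v c' ≤ v c).card

/-- Every voter of `V` has a strict (injective) preference on the candidate set `C`. -/
def StrictPrefs {α : Type} (C : Finset α) (V : List (α → ℕ)) : Prop :=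
  ∀ v ∈ V, Set.InjOn v ↑C

/-- The two norms parameterizing score-based rules. -/
inductive ScoreNorm : Type
  | l1
  | lmax

/-- Voter `v`'s score for a committee `S` on the pool `C` with target size `k`,
under the `(β, γ)`-rule (`γ m k p` is the position score of position `p` for
`m` candidates and target size `k`). -/
noncomputable def voterScore {α : Type} (β : ScoreNorm) (γ : ℕ → ℕ → ℕ → ℝ)
    (C : Finset α) (k : ℕ) (v : α → ℕ) (S : Finset α) : ℝ :=
  match β with
  | .l1 => ∑ c ∈ S, γ C.card k (posIn v C c)
  | .lmax => sSup ((fun c => γ C.card k (posIn v C c)) '' (S : Set α))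

/-- Total score `Σ_{v ∈ V} f_v(S)` of a committee. -/
noncomputable def totalScore {α : Type} (β : ScoreNorm) (γ : ℕ → ℕ → ℕ → ℝ)
    (C : Finset α) (V : List (α → ℕ)) (k : ℕ) (S : Finset α) : ℝ :=
  (V.map fun v => voterScore β γ C k v S).sum

/-- Winning committees of the single-stage `(β, γ)`-rule: the size-`k` committees
maximizing the total score. -/
def scoreWinners {α : Type} (β : ScoreNorm) (γ : ℕ → ℕ → ℕ → ℝ)
    (C : Finset α) (V : List (α → ℕ)) (k : ℕ) : Set (Finset α) :=
  {S | S ⊆ C ∧ S.card = k ∧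
    ∀ T ⊆ C, T.card = k → totalScore β γ C V k T ≤ totalScore β γ C V k S}

/-- Winning committees of the multi-stage `(β, γ)`-rule for stage vector `ks`:
the winning committee of each stage is the candidate pool of the next stage. -/
def msWinners {α : Type} (β : ScoreNorm) (γ : ℕ → ℕ → ℕ → ℝ) :
    List ℕ → Finset α → List (α → ℕ) → Set (Finset α)
  | [], C, _ => {C}
  | k :: ks, C, V => {S | ∃ S₁ ∈ scoreWinners β γ C V k, S ∈ msWinners β γ ks S₁ V}

/-- Each `γ^{m,k}` is non-increasing on the positions `1, …, m`. -/
def GammaMono (γ : ℕ → ℕ → ℕ → ℝ) : Prop :=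
  ∀ m k p q : ℕ, 1 ≤ p → p ≤ q → q ≤ m → γ m k q ≤ γ m k p

/-- Rationality of a `(β, γ)`-rule: for every pair `(m, k)` with `m > k ≥ 1`,
`γ^{m,k}(1) > γ^{m,k}(m)` when `β = ℓ₁`, and `γ^{m,k}(1) > γ^{m,k}(m-k+1)` when
`β = ℓ_max`. -/
def RationalRule : ScoreNorm → (ℕ → ℕ → ℕ → ℝ) → Prop
  | .l1, γ => ∀ m k : ℕ, 1 ≤ k → k < m → γ m k m < γ m k 1
  | .lmax, γ => ∀ m k : ℕ, 1 ≤ k → k < m → γ m k (m - k + 1) < γ m k 1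

/-- A valid stage vector for the candidate set `C`: `|C| > k_1 > … > k_t ≥ 1`. -/
def ValidVec {α : Type} (C : Finset α) (ks : List ℕ) : Prop :=
  List.Chain (· > ·) C.card ks ∧ ∀ k ∈ ks, 1 ≤ k

/-- The preference list obtained from `v` by swapping the positions of `c` and
`d`; when `d` is the candidate ranked directly above `c`, this shifts `c` one
position forward. -/
def shiftForward {α : Type} [DecidableEq α] (v : α → ℕ) (c d : α) : α → ℕ :=
  fun x => if x = c then v d else if x = d then v c else v x

/-- Candidate Monotonicity for the `t`-stage `(β, γ)`-rule: whenever a candidate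
`c` belongs to some winning committee and one voter shifts `c` one position
forward (swapping `c` with the candidate `d` ranked directly above `c`), `c`
still belongs to some winning committee. -/
def MSCandidateMonotone (β : ScoreNorm) (γ : ℕ → ℕ → ℕ → ℝ) (t : ℕ) : Prop :=
  ∀ (α : Type) [DecidableEq α] (C : Finset α) (V : List (α → ℕ)), StrictPrefs C V →
    ∀ (ks : List ℕ), ks ≠ [] → ks.length = t → ValidVec C ks →
    ∀ c ∈ C, (∃ S ∈ msWinners β γ ks C V, c ∈ S) →
    ∀ (i : ℕ) (hi : i < V.length) (d : α), d ∈ C → d ≠ c →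
      posIn (V.get ⟨i, hi⟩) C c = posIn (V.get ⟨i, hi⟩) C d + 1 →
      ∃ S' ∈ msWinners β γ ks C (V.set i (shiftForward (V.get ⟨i, hi⟩) c d)), c ∈ S'

/-- The plurality position score: `Plu^{m,k}(p) = 1` if `p = 1` and `0` otherwise. -/
noncomputable def pluGamma : ℕ → ℕ → ℕ → ℝ := fun _ _ p => if p = 1 then 1 else 0

/-- If every voter of `V` has the corresponding entry of `tops` as unique favorite on the pool `P`,
the SNTV score of a committee `S` is the number of entries of `tops` that lie in `S`. -/
theorem totalScore_l1_pluGamma_eq_countP {P : Finset ℕ} {V : List (ℕ → ℕ)} {tops : List ℕ}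
    (h : List.Forall₂ (fun v x => x ∈ P ∧ ∀ y ∈ P, y ≠ x → v x < v y) V tops)
    (k : ℕ) {S : Finset ℕ} (hS : S ⊆ P) :
    totalScore ScoreNorm.l1 pluGamma P V k S = (tops.countP (· ∈ S) : ℕ) := by
  have favorite_score {v : ℕ → ℕ} {x : ℕ} (hx : x ∈ P) (hv : ∀ y ∈ P, y ≠ x → v x < v y) :
      voterScore ScoreNorm.l1 pluGamma P k v S = if x ∈ S then 1 else 0 := by
    have hpos : ∀ y ∈ S, pluGamma P.card k (posIn v P y) = if x = y then 1 else 0 := by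
      intro y hy
      have hiff : posIn v P y = 1 ↔ x = y := by
        rw [posIn, Finset.card_eq_one]
        constructor
        · rintro ⟨a, ha⟩
          have hya : y ∈ ({a} : Finset ℕ) := by
            rw [← ha]
            simp [hS hy]
          have hxa : x ∈ ({a} : Finset ℕ) := by
            rw [← ha, Finset.mem_filter]
            refine ⟨hx, ?_⟩
            by_cases hyx : y = x
            · rw [hyx]
            · exact (hv y (hS hy) hyx).le
          rw [Finset.mem_singleton] at hya hxa
          rw [hya, hxa]
        · rintro rfl
          refine ⟨x, ?_⟩
          ext z
          simp only [Finset.mem_filter, Finset.mem_singleton]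
          constructor
          · rintro ⟨hz, hle⟩
            by_contra hzx
            exact absurd (hv z hz hzx) (not_lt.mpr hle)
          · rintro rfl
            exact ⟨hx, le_rfl⟩
      simp only [pluGamma, hiff]
    simp only [voterScore]
    rw [Finset.sum_congr rfl hpos, Finset.sum_ite_eq]
  unfold totalScore
  induction h with
  | nil => simp
  | cons hhead _ ih =>
    rw [List.map_cons, List.sum_cons, ih, favorite_score hhead.1 hhead.2, List.countP_cons]
    split_ifs <;> simp_all [add_comm]

/-- Membership in the set of SNTV winners, in terms of the voters' favorites. -/
theorem mem_scoreWinners_l1_pluGamma_iff {P : Finset ℕ} {V : List (ℕ → ℕ)} {tops : List ℕ}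
    (h : List.Forall₂ (fun v x => x ∈ P ∧ ∀ y ∈ P, y ≠ x → v x < v y) V tops)
    (k : ℕ) (S : Finset ℕ) :
    S ∈ scoreWinners ScoreNorm.l1 pluGamma P V k ↔
      S ∈ P.powersetCard k ∧
        ∀ T ∈ P.powersetCard k, tops.countP (· ∈ T) ≤ tops.countP (· ∈ S) := by
  simp only [scoreWinners, Set.mem_ofPred_eq, Finset.mem_powersetCard, and_assoc]
  refine and_congr_right fun hS => and_congr_right fun _ => ?_
  refine forall_congr' fun T => ?_
  rw [and_imp]
  refine forall_congr' fun hT => imp_congr_right fun _ => ?_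
  rw [totalScore_l1_pluGamma_eq_countP h k hT, totalScore_l1_pluGamma_eq_countP h k hS,
    Nat.cast_le]

/-- The voter ranking `0`, `1`, `2` at the positions `i`, `j`, `k`, and every further candidate at
the position given by its own value. -/
def coreVoter (i j k : ℕ) : ℕ → ℕ
  | 0 => i
  | 1 => j
  | 2 => k
  | n + 3 => n + 3

/-- Three voters `1 > 0 > 2`, three voters `2 > 1 > 0`, two voters `0 > 2 > 1`, headed by a voter
`v`. -/
def profileWith (v : ℕ → ℕ) : List (ℕ → ℕ) :=
  [v, coreVoter 1 0 2, coreVoter 1 0 2, coreVoter 1 0 2, coreVoter 2 1 0, coreVoter 2 1 0,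
    coreVoter 2 1 0, coreVoter 0 2 1, coreVoter 0 2 1]

/-- The stage vector `(t, t - 1, …, 1)`. -/
def descendingStages : ℕ → List ℕ
  | 0 => []
  | n + 1 => (n + 1) :: descendingStages n

theorem length_descendingStages (n : ℕ) : (descendingStages n).length = n := by
  induction n with
  | zero => rfl
  | succ n ih => simp [descendingStages, ih]

theorem validVec_descendingStages (n : ℕ) :
    ValidVec (Finset.range (n + 1)) (descendingStages n) := by
  induction n with
  | zero => exact ⟨List.IsChain.singleton _, by simp [descendingStages]⟩
  | succ n ih =>
    simp only [ValidVec, descendingStages, Finset.card_range] at ih ⊢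
    refine ⟨List.IsChain.cons_cons (Nat.lt_succ_self _) ih.1, ?_⟩
    simpa using ih.2

theorem favorites_profileWith_coreVoter_zero_one_two {P : Finset ℕ} (hP : {0, 1, 2} ⊆ P) :
    List.Forall₂ (fun v x => x ∈ P ∧ ∀ y ∈ P, y ≠ x → v x < v y)
      (profileWith (coreVoter 0 1 2)) [0, 1, 1, 1, 2, 2, 2, 0, 0] := by
  simp only [Finset.insert_subset_iff, Finset.singleton_subset_iff] at hP
  simp only [profileWith, List.forall₂_cons, List.forall₂_nil_left_iff, and_true, hP, true_and]
  refine ⟨?_, ?_, ?_, ?_, ?_, ?_, ?_, ?_, ?_⟩ <;>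
    · rintro (_ | _ | _ | y) - hy <;> simp [coreVoter] at hy ⊢

theorem favorites_profileWith_coreVoter_one_zero_two {P : Finset ℕ} (hP : {0, 1, 2} ⊆ P) :
    List.Forall₂ (fun v x => x ∈ P ∧ ∀ y ∈ P, y ≠ x → v x < v y)
      (profileWith (coreVoter 1 0 2)) [1, 1, 1, 1, 2, 2, 2, 0, 0] := by
  simp only [Finset.insert_subset_iff, Finset.singleton_subset_iff] at hP
  simp only [profileWith, List.forall₂_cons, List.forall₂_nil_left_iff, and_true, hP, true_and]
  refine ⟨?_, ?_, ?_, ?_, ?_, ?_, ?_, ?_, ?_⟩ <;>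
    · rintro (_ | _ | _ | y) - hy <;> simp [coreVoter] at hy ⊢

/-- Before the shift, candidate `1` can win. -/
theorem singleton_one_mem_msWinners (n : ℕ) :
    {1} ∈ msWinners ScoreNorm.l1 pluGamma (descendingStages (n + 2)) (Finset.range (n + 3))
      (profileWith (coreVoter 0 1 2)) := by
  induction n with
  | zero =>
    refine ⟨{0, 1}, ?_, {1}, ?_, rfl⟩
    · rw [mem_scoreWinners_l1_pluGamma_iff
        (favorites_profileWith_coreVoter_zero_one_two (by decide))]
      decide
    · have h : List.Forall₂
          (fun v x => x ∈ ({0, 1} : Finset ℕ) ∧ ∀ y ∈ ({0, 1} : Finset ℕ), y ≠ x → v x < v y)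
          (profileWith (coreVoter 0 1 2)) [0, 1, 1, 1, 1, 1, 1, 0, 0] := by
        simp [profileWith, coreVoter]
      rw [mem_scoreWinners_l1_pluGamma_iff h]
      decide
  | succ n ih =>
    have hcore (k : ℕ) : {0, 1, 2} ⊆ Finset.range (k + 3) := by
      simp [Finset.insert_subset_iff]
    refine ⟨Finset.range (n + 3), ?_, ih⟩
    rw [mem_scoreWinners_l1_pluGamma_iff
      (favorites_profileWith_coreVoter_zero_one_two (hcore (n + 1)))]
    refine ⟨?_, fun T _ => List.countP_le_length.trans_eq ?_⟩
    · simp [Finset.mem_powersetCard]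
    · simp

/-- After the shift, candidate `1` cannot win: `0` is eliminated instead of `2`, and `2` beats `1`
in the last stage. -/
theorem one_notMem_of_mem_msWinners (n : ℕ) {P S : Finset ℕ} (hP : {0, 1, 2} ⊆ P)
    (hcard : P.card = n + 3)
    (hS : S ∈ msWinners ScoreNorm.l1 pluGamma (descendingStages (n + 2)) P
      (profileWith (coreVoter 1 0 2))) : 1 ∉ S := by
  induction n generalizing P with
  | zero =>
    obtain rfl : {0, 1, 2} = P := Finset.eq_of_subset_of_card_le hP (by simp [hcard])
    obtain ⟨Q, hQ, R, hR, rfl⟩ := hS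
    rw [mem_scoreWinners_l1_pluGamma_iff
      (favorites_profileWith_coreVoter_one_zero_two hP)] at hQ
    obtain rfl : Q = {1, 2} := by
      have key : ∀ Q ∈ Finset.powersetCard 2 ({0, 1, 2} : Finset ℕ),
          (∀ T ∈ Finset.powersetCard 2 ({0, 1, 2} : Finset ℕ),
            [1, 1, 1, 1, 2, 2, 2, 0, 0].countP (· ∈ T) ≤
              [1, 1, 1, 1, 2, 2, 2, 0, 0].countP (· ∈ Q)) → Q = {1, 2} := by decide
      exact key Q hQ.1 hQ.2
    have h : List.Forall₂
        (fun v x => x ∈ ({1, 2} : Finset ℕ) ∧ ∀ y ∈ ({1, 2} : Finset ℕ), y ≠ x → v x < v y)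
        (profileWith (coreVoter 1 0 2)) [1, 1, 1, 1, 2, 2, 2, 2, 2] := by
      simp [profileWith, coreVoter]
    rw [mem_scoreWinners_l1_pluGamma_iff h] at hR
    have key : ∀ R ∈ Finset.powersetCard 1 ({1, 2} : Finset ℕ),
        (∀ T ∈ Finset.powersetCard 1 ({1, 2} : Finset ℕ),
          [1, 1, 1, 1, 2, 2, 2, 2, 2].countP (· ∈ T) ≤
            [1, 1, 1, 1, 2, 2, 2, 2, 2].countP (· ∈ R)) → 1 ∉ R := by decide
    exact key S hR.1 hR.2
  | succ n ih =>
    obtain ⟨Q, hQ, hS⟩ := hS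
    rw [mem_scoreWinners_l1_pluGamma_iff
      (favorites_profileWith_coreVoter_one_zero_two hP), Finset.mem_powersetCard] at hQ
    obtain ⟨⟨-, hQcard⟩, hmax⟩ := hQ
    obtain ⟨T, hT, hTP, hTcard⟩ := Finset.exists_subsuperset_card_eq (n := n + 3) hP
      (by simp) (by lia)
    have hlen := hmax T (Finset.mem_powersetCard.mpr ⟨hTP, hTcard⟩)
    have hTall : [1, 1, 1, 1, 2, 2, 2, 0, 0].countP (· ∈ T) =
        [1, 1, 1, 1, 2, 2, 2, 0, 0].length := by
      simp only [Finset.insert_subset_iff, Finset.singleton_subset_iff] at hT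
      simp [hT]
    rw [hTall] at hlen
    have hQall := List.countP_eq_length.mp (le_antisymm List.countP_le_length hlen)
    refine ih (P := Q) ?_ hQcard hS
    simp at hQall
    simp [Finset.insert_subset_iff, hQall]

/-- For every `t ≥ 2`, the `t`-stage `(ℓ₁, Plu)`-rule (SNTV at
every stage; in particular the STV procedure) does not satisfy Candidate
Monotonicity. -/
theorem multistage_sntv_not_candidate_monotone (t : ℕ) (ht : 2 ≤ t) :
    ¬ MSCandidateMonotone ScoreNorm.l1 pluGamma t := by
  obtain ⟨n, rfl⟩ := Nat.exists_eq_add_of_le' ht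
  intro hmono
  have hstrict : StrictPrefs (Finset.range (n + 3)) (profileWith (coreVoter 0 1 2)) := by
    simp only [StrictPrefs, profileWith, List.forall_mem_cons]
    refine ⟨?_, ?_, ?_, ?_, ?_, ?_, ?_, ?_, ?_, by simp⟩ <;>
      · rintro (_ | _ | _ | x) - (_ | _ | _ | y) - hxy <;> simp [coreVoter] at hxy ⊢ <;> lia
  have hcoreVoter : coreVoter 0 1 2 = id := by
    funext x
    rcases x with _ | _ | _ | x <;> rfl
  have hshift : shiftForward (coreVoter 0 1 2) 1 0 = coreVoter 1 0 2 := by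
    funext x
    rcases x with _ | _ | _ | x <;> simp [shiftForward, coreVoter]
  have hpos : posIn (coreVoter 0 1 2) (Finset.range (n + 3)) 1 =
      posIn (coreVoter 0 1 2) (Finset.range (n + 3)) 0 + 1 := by
    have h1 : (Finset.range (n + 3)).filter (· ≤ 1) = {0, 1} := by
      ext x
      simp
      lia
    have h0 : (Finset.range (n + 3)).filter (· ≤ 0) = {0} := by
      ext x
      simp
    simp only [posIn, hcoreVoter, id]
    rw [h1, h0]
    rfl
  obtain ⟨S, hS, hmem⟩ := hmono ℕ (Finset.range (n + 3)) (profileWith (coreVoter 0 1 2)) hstrict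
    (descendingStages (n + 2)) (by simp [descendingStages]) (length_descendingStages _)
    (validVec_descendingStages _) 1 (by simp)
    ⟨{1}, singleton_one_mem_msWinners n, by simp⟩ 0 (by simp [profileWith]) 0 (by simp) (by simp)
    hpos
  have hset : (profileWith (coreVoter 0 1 2)).set 0 (shiftForward (coreVoter 0 1 2) 1 0) =
      profileWith (coreVoter 1 0 2) := by
    rw [hshift]
    rfl
  refine one_notMem_of_mem_msWinners n (P := Finset.range (n + 3)) ?_ (by simp) (hset ▸ hS) hmem
  simp [Finset.insert_subset_iff]
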